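/- arXiv:1806.10262 — 3 statements merged into one kernel-verified Lean document; each statement's English description precedes it below -/
import Mathlib

section
/- For every integer N ≥ 3, the (N−1)×(N−1) real matrix A_0 is invertible. -/
open scoped Matrix

/-- The coefficients `g_k^{(β)}`. -/
noncomputable def gcoef (β : ℝ) : ℕ → ℝ
  | 0 => 1
  | k + 1 => (1 - (β + 1) / ((k : ℝ) + 1)) * gcoef β k

/-- The WSGD coefficients `ω_k^{(β)}`. -/
noncomputable def w (β : ℝ) : ℕ → ℝ
  | 0 => β / 2 * gcoef β 0
  | k + 1 => β / 2 * gcoef β (k + 1) + (2 - β) / 2 * gcoef β k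
/-- The `(N−1) × (N−1)` lower Hessenberg Toeplitz matrix `G_β`
(1-based entry `(i,j)` equals `ω_{i−j+1}` when `i − j + 1 ≥ 0`, else `0`). -/
noncomputable def Gmat (β : ℝ) (N : ℕ) : Matrix (Fin (N - 1)) (Fin (N - 1)) ℝ :=
  Matrix.of fun i j => if (j : ℕ) ≤ (i : ℕ) + 1 then w β ((i : ℕ) + 1 - (j : ℕ)) else 0

/-- `K_N = e₁·G_β + e₂·G_βᵀ`. -/
noncomputable def Kmat (β e1 e2 : ℝ) (N : ℕ) : Matrix (Fin (N - 1)) (Fin (N - 1)) ℝ :=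
  e1 • Gmat β N + e2 • (Gmat β N)ᵀ
/-- `c_0^{(α,σ)} = τ^{−α}·σ^{1−α}/Γ(2−α)` with `σ = 1 − α/2`. -/
noncomputable def c0 (α τ : ℝ) : ℝ :=
  τ ^ (-α) * (1 - α / 2) ^ (1 - α) / Real.Gamma (2 - α)

/-- `A_0 = h^β·c_0^{(α,σ)}·I − σ·K_N` with `σ = 1 − α/2`. -/
noncomputable def A0mat (β α h τ e1 e2 : ℝ) (N : ℕ) :
    Matrix (Fin (N - 1)) (Fin (N - 1)) ℝ :=
  (h ^ β * c0 α τ) • (1 : Matrix (Fin (N - 1)) (Fin (N - 1)) ℝ) -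
    (1 - α / 2) • Kmat β e1 e2 N

/-- off-diagonal Toeplitz symbol of `G + Gᵀ` -/
noncomputable def sco (β : ℝ) : ℕ → ℝ
  | 0 => 2 * w β 1
  | 1 => w β 0 + w β 2
  | k + 2 => w β (k + 3)

lemma gcoef_one (β : ℝ) : gcoef β 1 = -β := by
  simp [gcoef]

lemma gcoef_two (β : ℝ) : gcoef β 2 = β * (β - 1) / 2 := by
  rw [gcoef, gcoef_one]; push_cast; ring

lemma gcoef_rec (β : ℝ) (k : ℕ) :
    ((k : ℝ) + 1) * gcoef β (k + 1) = ((k : ℝ) - β) * gcoef β k := by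
  have : ((k : ℝ) + 1) ≠ 0 := by positivity
  rw [gcoef]; field_simp; ring

lemma gcoef_nonneg (β : ℝ) (h1 : 1 < β) (h2 : β < 2) (k : ℕ) : 0 ≤ gcoef β (k + 2) := by
  induction k with
  | zero => rw [gcoef_two]; nlinarith
  | succ k ih =>
    have h := gcoef_rec β (k + 2)
    push_cast at h
    have hk : (0 : ℝ) ≤ k := Nat.cast_nonneg k
    have h3 : 0 ≤ ((k : ℝ) + 2 + 1) * gcoef β (k + 2 + 1) := by
      rw [h]; exact mul_nonneg (by linarith) ih
    exact nonneg_of_mul_nonneg_right h3 (by linarith)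

lemma w_one (β : ℝ) : w β 1 = (2 - β - β ^ 2) / 2 := by
  simp only [w, gcoef_one, gcoef]; ring

lemma w_zero (β : ℝ) : w β 0 = β / 2 := by
  simp [w, gcoef]

lemma w_two (β : ℝ) : w β 2 = β * (β ^ 2 + β - 4) / 4 := by
  rw [w, gcoef_one, gcoef_two]; ring

lemma sco_nonneg (β : ℝ) (h1 : 1 < β) (h2 : β < 2) (k : ℕ) : 0 ≤ sco β (k + 1) := by
  cases k with
  | zero =>
    have : sco β (0 + 1) = β * ((β - 1) * (β + 2)) / 4 := by
      simp only [sco, w_zero, w_two, zero_add]; ring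
    rw [this]
    have : 0 ≤ (β - 1) * (β + 2) := mul_nonneg (by linarith) (by linarith)
    have := mul_nonneg (by linarith : 0 ≤ β) this
    linarith
  | succ k =>
    have a := gcoef_nonneg β h1 h2 k
    have b := gcoef_nonneg β h1 h2 (k + 1)
    change 0 ≤ w β (k + 3)
    rw [w]
    exact add_nonneg (mul_nonneg (by linarith) b) (mul_nonneg (by linarith) a)

lemma sum_sco (β : ℝ) (m : ℕ) :
    2 * β * (∑ k ∈ Finset.range (m + 1), sco β (k + 1) + w β 1) =
      -(β * ((m : ℝ) + 3) * gcoef β (m + 3) + (2 - β) * ((m : ℝ) + 2) * gcoef β (m + 2)) := by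
  induction m with
  | zero =>
    have h := gcoef_rec β 2
    rw [gcoef_two] at h
    push_cast at h
    have h' : gcoef β 3 = (2 - β) * (β * (β - 1) / 2) / 3 := by
      rw [← h]; ring
    simp only [zero_add, Finset.sum_range_one, sco, w_zero, w_one, w_two, gcoef_two, h']
    push_cast; ring
  | succ m ih =>
    rw [Finset.sum_range_succ]
    have h := gcoef_rec β (m + 3)
    have e : sco β (m + 1 + 1) = β / 2 * gcoef β (m + 3) + (2 - β) / 2 * gcoef β (m + 2) := rfl
    rw [e]
    have e2 : m + 1 + 3 = m + 3 + 1 := by ring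
    have e3 : m + 1 + 2 = m + 3 := by ring
    rw [e2, e3]
    have h0 := gcoef_rec β (m + 2)
    push_cast at h h0 ⊢
    rw [show m + 2 + 1 = m + 3 from rfl] at h0
    linear_combination ih + β * h + (2 - β) * h0

lemma sum_sco_le (β : ℝ) (h1 : 1 < β) (h2 : β < 2) (m : ℕ) :
    ∑ k ∈ Finset.range m, sco β (k + 1) ≤ - w β 1 := by
  cases m with
  | zero => simp [w_one]; nlinarith
  | succ m =>
    have h := sum_sco β m
    have a := gcoef_nonneg β h1 h2 m
    have b := gcoef_nonneg β h1 h2 (m + 1)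
    have hm : (0 : ℝ) ≤ m := Nat.cast_nonneg m
    have c1 : 0 ≤ β * ((m : ℝ) + 3) * gcoef β (m + 3) :=
      mul_nonneg (mul_nonneg (by linarith) (by linarith)) b
    have c2 : 0 ≤ (2 - β) * ((m : ℝ) + 2) * gcoef β (m + 2) :=
      mul_nonneg (mul_nonneg (by linarith) (by linarith)) a
    by_contra! hc
    have := mul_pos (by linarith : 0 < 2 * β)
      (by linarith : 0 < ∑ k ∈ Finset.range (m + 1), sco β (k + 1) + w β 1)
    linarith

lemma row_sum_le (β : ℝ) (h1 : 1 < β) (h2 : β < 2) (n : ℕ) (i : Fin n) :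
    ∑ j : Fin n, sco β ((i : ℕ) - j + (j - i)) ≤ 0 := by
  rw [Fin.sum_univ_eq_sum_range (fun j => sco β ((i : ℕ) - j + (j - i)))]
  obtain ⟨i, hi⟩ := i
  obtain ⟨m, rfl⟩ : ∃ m, n = (i + 1) + m := ⟨n - (i + 1), by omega⟩
  rw [Finset.sum_range_add, Finset.sum_range_succ]
  have A : ∑ j ∈ Finset.range i, sco β (i - j + (j - i)) =
      ∑ k ∈ Finset.range i, sco β (k + 1) := by
    rw [← Finset.sum_range_reflect]
    refine Finset.sum_congr rfl fun j hj => ?_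
    have := Finset.mem_range.1 hj
    congr 1; omega
  have B : ∑ x ∈ Finset.range m, sco β (i - (i + 1 + x) + (i + 1 + x - i)) =
      ∑ k ∈ Finset.range m, sco β (k + 1) := by
    refine Finset.sum_congr rfl fun j hj => ?_
    congr 1; omega
  have C : sco β (i - i + (i - i)) = 2 * w β 1 := by simp [sco]
  simp only [A, B, C]
  have := sum_sco_le β h1 h2 i
  have := sum_sco_le β h1 h2 m
  linarith

lemma G_sym (β : ℝ) (N : ℕ) (i j : Fin (N - 1)) :
    Gmat β N i j + Gmat β N j i = sco β ((i : ℕ) - j + (j - i)) := by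
  obtain ⟨i, hi⟩ := i
  obtain ⟨j, hj⟩ := j
  simp only [Gmat, Matrix.of_apply]
  have key : ∀ i d : ℕ, (if i + d ≤ i + 1 then w β (i + 1 - (i + d)) else 0) +
      (if i ≤ i + d + 1 then w β (i + d + 1 - i) else 0) = sco β d := by
    intro i d
    rw [if_pos (show i ≤ i + d + 1 by omega), show i + d + 1 - i = d + 1 by omega]
    match d with
    | 0 => simp [sco]; ring
    | 1 => simp [sco]
    | d + 2 => rw [if_neg (by omega)]; simp [sco]
  rcases le_total i j with h | h
  · obtain ⟨d, rfl⟩ := Nat.exists_eq_add_of_le h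
    rw [key, show i - (i + d) + (i + d - i) = d by omega]
  · obtain ⟨d, rfl⟩ := Nat.exists_eq_add_of_le h
    rw [add_comm, key, show j + d - j + (j - (j + d)) = d by omega]

lemma quad_nonpos (β : ℝ) (h1 : 1 < β) (h2 : β < 2) (N : ℕ) (x : Fin (N - 1) → ℝ) :
    x ⬝ᵥ (Gmat β N *ᵥ x) ≤ 0 := by
  set S : Fin (N - 1) → Fin (N - 1) → ℝ := fun i j => sco β ((i : ℕ) - j + (j - i)) with hS
  have hq : x ⬝ᵥ (Gmat β N *ᵥ x) = ∑ i, ∑ j, x i * Gmat β N i j * x j := by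
    simp only [dotProduct, Matrix.mulVec, Finset.mul_sum, mul_assoc]
  have hq' : x ⬝ᵥ (Gmat β N *ᵥ x) = ∑ i, ∑ j, x i * Gmat β N j i * x j := by
    rw [hq, Finset.sum_comm]
    exact Finset.sum_congr rfl fun i _ => Finset.sum_congr rfl fun j _ => by ring
  have h2q : 2 * (x ⬝ᵥ (Gmat β N *ᵥ x)) = ∑ i, ∑ j, x i * S i j * x j := by
    rw [two_mul]; nth_rewrite 1 [hq]; rw [hq', ← Finset.sum_add_distrib]
    refine Finset.sum_congr rfl fun i _ => ?_
    rw [← Finset.sum_add_distrib]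
    refine Finset.sum_congr rfl fun j _ => ?_
    rw [hS]; simp only; rw [← G_sym]; ring
  have Ssymm : ∀ i j, S i j = S j i := fun i j => by simp only [hS]; rw [add_comm]
  have hle : ∑ i, ∑ j, x i * S i j * x j ≤ ∑ i, ∑ j, S i j * (x i ^ 2 / 2 + x j ^ 2 / 2) := by
    refine Finset.sum_le_sum fun i _ => Finset.sum_le_sum fun j _ => ?_
    by_cases hij : i = j
    · subst hij; apply le_of_eq; ring
    · have : 0 ≤ S i j := by
        have hne : (i : ℕ) ≠ j := fun h => hij (Fin.ext h)
        obtain ⟨k, hk⟩ : ∃ k, (i : ℕ) - j + (j - i) = k + 1 :=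
          ⟨(i : ℕ) - j + (j - i) - 1, by omega⟩
        simp only [hS, hk]; exact sco_nonneg β h1 h2 k
      nlinarith [mul_nonneg this (sq_nonneg (x i - x j))]
  have hR : ∑ i, ∑ j, S i j * (x i ^ 2 / 2 + x j ^ 2 / 2) = ∑ i, x i ^ 2 * ∑ j, S i j := by
    have e1 : ∑ i, ∑ j, S i j * (x j ^ 2 / 2) = ∑ i, ∑ j, S i j * (x i ^ 2 / 2) := by
      rw [Finset.sum_comm]
      exact Finset.sum_congr rfl fun i _ => Finset.sum_congr rfl fun j _ => by rw [Ssymm]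
    simp only [mul_add, Finset.sum_add_distrib]
    rw [e1, ← Finset.sum_add_distrib]
    refine Finset.sum_congr rfl fun i _ => ?_
    rw [← Finset.sum_mul]; ring
  have : ∑ i, x i ^ 2 * ∑ j, S i j ≤ 0 :=
    Finset.sum_nonpos fun i _ =>
      mul_nonpos_of_nonneg_of_nonpos (sq_nonneg _) (row_sum_le β h1 h2 _ i)
  linarith

theorem A0_invertible (N : ℕ) (hN : 3 ≤ N)
    (β α h τ e1 e2 : ℝ) (hβ1 : 1 < β) (hβ2 : β < 2)
    (hα0 : 0 < α) (hα1 : α < 1) (hh : 0 < h) (hτ : 0 < τ)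
    (he1 : 0 < e1) (he2 : 0 < e2) :
    IsUnit (A0mat β α h τ e1 e2 N) := by
  rw [Matrix.isUnit_iff_isUnit_det, isUnit_iff_ne_zero]
  intro hdet
  obtain ⟨x, hx0, hx⟩ := Matrix.exists_mulVec_eq_zero_iff.2 hdet
  have hc : 0 < h ^ β * c0 α τ := by
    unfold c0
    have := Real.Gamma_pos_of_pos (show 0 < 2 - α by linarith)
    have : 0 < 1 - α / 2 := by linarith
    positivity
  have hxx : 0 < x ⬝ᵥ x := by
    obtain ⟨i, hi⟩ := Function.ne_iff.1 hx0
    exact Finset.sum_pos' (fun i _ => mul_self_nonneg _) ⟨i, Finset.mem_univ _, mul_self_pos.2 hi⟩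
  have hq := quad_nonpos β hβ1 hβ2 N x
  have ht : x ⬝ᵥ ((Gmat β N)ᵀ *ᵥ x) = x ⬝ᵥ (Gmat β N *ᵥ x) := by
    rw [Matrix.mulVec_transpose, dotProduct_comm, Matrix.dotProduct_mulVec]
  have hz : x ⬝ᵥ (A0mat β α h τ e1 e2 N *ᵥ x) = 0 := by rw [hx]; simp
  simp only [A0mat, Kmat, Matrix.sub_mulVec, Matrix.add_mulVec, Matrix.smul_mulVec,
    Matrix.one_mulVec, dotProduct_sub, dotProduct_add, dotProduct_smul, ht, smul_eq_mul] at hz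
  have p1 := mul_pos hc hxx
  have p2 : (1 - α / 2) * (e1 * (x ⬝ᵥ (Gmat β N *ᵥ x)) + e2 * (x ⬝ᵥ (Gmat β N *ᵥ x))) ≤ 0 :=
    mul_nonpos_of_nonneg_of_nonpos (by linarith)
      (add_nonpos (mul_nonpos_of_nonneg_of_nonpos he1.le hq)
        (mul_nonpos_of_nonneg_of_nonpos he2.le hq))
  linarith
end

section
/- For all integers N ≥ 3 and M ≥ 3, the block lower triangular Toeplitz matrix W is invertible. -/
open scoped Matrix

/-- `a_l^{(α,σ)}` with `σ = 1 − α/2`. -/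
noncomputable def acoef (α : ℝ) (l : ℕ) : ℝ :=
  ((l : ℝ) + (1 - α / 2)) ^ (1 - α) - ((l : ℝ) - 1 + (1 - α / 2)) ^ (1 - α)

/-- `b_l^{(α,σ)}` with `σ = 1 − α/2`. -/
noncomputable def bcoef (α : ℝ) (l : ℕ) : ℝ :=
  (1 / (2 - α)) * (((l : ℝ) + (1 - α / 2)) ^ (2 - α) - ((l : ℝ) - 1 + (1 - α / 2)) ^ (2 - α)) -
    (1 / 2) * (((l : ℝ) + (1 - α / 2)) ^ (1 - α) - ((l : ℝ) - 1 + (1 - α / 2)) ^ (1 - α))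

/-- `c_k^{(α,σ)}`. -/
noncomputable def ccoef (α τ : ℝ) : ℕ → ℝ
  | 0 => c0 α τ
  | k + 1 => τ ^ (-α) / Real.Gamma (2 - α) *
      (acoef α (k + 1) + bcoef α (k + 2) - bcoef α (k + 1))

/-- `A_1 = h^β·(c_1 − c_0)·I − (1 − σ)·K_N` with `σ = 1 − α/2`. -/
noncomputable def A1mat (β α h τ e1 e2 : ℝ) (N : ℕ) :
    Matrix (Fin (N - 1)) (Fin (N - 1)) ℝ :=
  (h ^ β * (ccoef α τ 1 - ccoef α τ 0)) • (1 : Matrix (Fin (N - 1)) (Fin (N - 1)) ℝ) -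
    (1 - (1 - α / 2)) • Kmat β e1 e2 N

/-- The blocks `A_k` of the block lower triangular Toeplitz matrix `W`:
`A_0`, `A_1` as above, and `A_k = h^β(c_k − c_{k−1})·I` for `k ≥ 2`. -/
noncomputable def Ablk (β α h τ e1 e2 : ℝ) (N : ℕ) (k : ℕ) :
    Matrix (Fin (N - 1)) (Fin (N - 1)) ℝ :=
  if k = 0 then A0mat β α h τ e1 e2 N
  else if k = 1 then A1mat β α h τ e1 e2 N
  else (h ^ β * (ccoef α τ k - ccoef α τ (k - 1))) • (1 : Matrix (Fin (N - 1)) (Fin (N - 1)) ℝ)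

/-- The block lower triangular block-Toeplitz matrix `W`
whose `(i,j)` block equals `A_{i−j}` for `i ≥ j` and `0` for `i < j`. -/
noncomputable def Wmat (β α h τ e1 e2 : ℝ) (M N : ℕ) :
    Matrix (Fin (M - 1) × Fin (N - 1)) (Fin (M - 1) × Fin (N - 1)) ℝ :=
  Matrix.of fun p q =>
    if (q.1 : ℕ) ≤ (p.1 : ℕ) then Ablk β α h τ e1 e2 N ((p.1 : ℕ) - (q.1 : ℕ)) p.2 q.2 else 0

/-- The block lower bidiagonal Toeplitz preconditioner `P_W`
with diagonal blocks `A_0` and first subdiagonal blocks `A_1`. -/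
noncomputable def PWmat (β α h τ e1 e2 : ℝ) (M N : ℕ) :
    Matrix (Fin (M - 1) × Fin (N - 1)) (Fin (M - 1) × Fin (N - 1)) ℝ :=
  Matrix.of fun p q =>
    if (p.1 : ℕ) = (q.1 : ℕ) then A0mat β α h τ e1 e2 N p.2 q.2
    else if (p.1 : ℕ) = (q.1 : ℕ) + 1 then A1mat β α h τ e1 e2 N p.2 q.2
    else 0


lemma g_pos (β : ℝ) (h1 : 1 < β) (h2 : β < 2) (k : ℕ) : 0 < gcoef β (k + 2) := by
  induction k with
  | zero =>
    simp only [gcoef]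
    norm_num
    nlinarith
  | succ k ih =>
    rw [show k + 1 + 2 = (k + 2) + 1 by ring, gcoef]
    refine mul_pos ?_ ih
    push_cast
    rw [sub_pos, div_lt_one (by positivity)]
    have : (0 : ℝ) ≤ k := by positivity
    linarith

lemma w_pos (β : ℝ) (h1 : 1 < β) (h2 : β < 2) (k : ℕ) : 0 < w β (k + 3) := by
  rw [show k + 3 = (k + 2) + 1 by ring, w, gcoef]
  have hg := g_pos β h1 h2 k
  have hk : (0 : ℝ) ≤ k := by positivity
  have : β / 2 * ((1 - (β + 1) / (((k + 2 : ℕ) : ℝ) + 1)) * gcoef β (k + 2))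
      + (2 - β) / 2 * gcoef β (k + 2)
      = gcoef β (k + 2) * (1 - (β * (β + 1) / 2) / ((k : ℝ) + 3)) := by
    push_cast
    have : (k : ℝ) + 3 ≠ 0 := by positivity
    have : (k : ℝ) + 2 + 1 ≠ 0 := by positivity
    field_simp
    ring
  rw [this]
  refine mul_pos hg ?_
  rw [sub_pos, div_lt_one (by positivity)]
  nlinarith

/-- Partial sums of the `g` coefficients. -/
lemma g_sum (β : ℝ) (k : ℕ) :
    ∑ j ∈ Finset.range (k + 2), gcoef β j = - gcoef β (k + 1) * ((k : ℝ) + 1 - β) / β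
      ∨ β = 0 := by
  by_cases hb : β = 0
  · exact Or.inr hb
  left
  induction k with
  | zero =>
    simp [Finset.sum_range_succ, gcoef]
    field_simp
    ring
  | succ k ih =>
    have hg : gcoef β (k + 1 + 1)
        = (1 - (β + 1) / (((k + 1 : ℕ) : ℝ) + 1)) * gcoef β (k + 1) := rfl
    rw [Finset.sum_range_succ, ih, show k + 2 = k + 1 + 1 by ring, hg]
    push_cast
    have : (k : ℝ) + 1 + 1 ≠ 0 := by positivity
    field_simp
    ring

lemma g_sum_neg (β : ℝ) (h1 : 1 < β) (h2 : β < 2) (k : ℕ) :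
    ∑ j ∈ Finset.range (k + 2), gcoef β j < 0 := by
  rcases g_sum β k with h | h
  · rw [h]
    cases k with
    | zero =>
      simp [gcoef]
      rw [div_neg_iff]
      right
      constructor <;> nlinarith
    | succ k =>
      have hg := g_pos β h1 h2 k
      have hk : (0 : ℝ) ≤ k := by positivity
      rw [div_neg_iff]
      right
      refine ⟨?_, by linarith⟩
      push_cast
      rw [show k + 1 + 1 = k + 2 by ring]
      have : 0 < (k : ℝ) + 1 + 1 - β := by linarith
      nlinarith [mul_pos hg this]
  · linarith

lemma w_sum (β : ℝ) (k : ℕ) :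
    ∑ j ∈ Finset.range (k + 1), w β j =
      β / 2 * ∑ j ∈ Finset.range (k + 1), gcoef β j
        + (2 - β) / 2 * ∑ j ∈ Finset.range k, gcoef β j := by
  induction k with
  | zero => simp [w]
  | succ k ih =>
    rw [Finset.sum_range_succ, ih, w, Finset.sum_range_succ _ (k + 1), Finset.sum_range_succ _ k]
    ring

lemma w_sum_neg (β : ℝ) (h1 : 1 < β) (h2 : β < 2) (k : ℕ) :
    ∑ j ∈ Finset.range (k + 3), w β j < 0 := by
  rw [show k + 3 = (k + 2) + 1 by ring, w_sum]
  have a := g_sum_neg β h1 h2 k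
  have b := g_sum_neg β h1 h2 (k + 1)
  rw [show k + 1 + 2 = k + 2 + 1 by ring] at b
  nlinarith

/-- Symbol of the symmetrised Toeplitz matrix. -/
noncomputable def tco (β : ℝ) : ℕ → ℝ
  | 0 => 2 * w β 1
  | 1 => w β 0 + w β 2
  | k + 2 => w β (k + 3)

lemma tco_nonneg (β : ℝ) (h1 : 1 < β) (h2 : β < 2) (k : ℕ) : 0 ≤ tco β (k + 1) := by
  cases k with
  | zero =>
    simp [tco, w, gcoef]
    nlinarith [mul_pos (by linarith : 0 < β) (by linarith : 0 < β - 1)]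
  | succ k => exact (w_pos β h1 h2 k).le

lemma tco_half (β : ℝ) (h1 : 1 < β) (h2 : β < 2) (p : ℕ) :
    w β 1 + ∑ d ∈ Finset.range p, tco β (d + 1) ≤ 0 := by
  cases p with
  | zero =>
    simp [w, gcoef]
    nlinarith
  | succ p =>
    have : w β 1 + ∑ d ∈ Finset.range (p + 1), tco β (d + 1)
        = ∑ j ∈ Finset.range (p + 3), w β j := by
      induction p with
      | zero =>
        simp [Finset.sum_range_succ, tco]
        ring
      | succ p ih =>
        rw [Finset.sum_range_succ, ← add_assoc, ih, Finset.sum_range_succ _ (p + 3)]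
        rfl
    rw [this]
    exact (w_sum_neg β h1 h2 p).le

lemma sym_entry (β : ℝ) (N : ℕ) (i j : Fin (N - 1)) :
    Gmat β N i j + Gmat β N j i = tco β (((i : ℕ) - j) + ((j : ℕ) - i)) := by
  have key : ∀ a b : ℕ, a ≤ b →
      ((if b ≤ a + 1 then w β (a + 1 - b) else 0) + (if a ≤ b + 1 then w β (b + 1 - a) else 0))
        = tco β (b - a) := by
    intro a b hab
    obtain ⟨d, rfl⟩ := Nat.exists_eq_add_of_le hab
    rw [show a + d - a = d by omega, show a + d + 1 - a = d + 1 by omega,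
      if_pos (show a ≤ a + d + 1 by omega)]
    match d with
    | 0 => simp [tco]; ring
    | 1 => simp [tco]
    | d + 2 => rw [if_neg (by omega)]; simp [tco]
  simp only [Gmat, Matrix.of_apply]
  rcases le_total (i : ℕ) j with h | h
  · rw [key _ _ h, Nat.sub_eq_zero_of_le h, zero_add]
  · rw [add_comm, key _ _ h, Nat.sub_eq_zero_of_le h, add_zero]

lemma row_sum (β : ℝ) (h1 : 1 < β) (h2 : β < 2) (n : ℕ) (i : Fin n) :
    ∑ j : Fin n, tco β (((i : ℕ) - j) + ((j : ℕ) - i)) ≤ 0 := by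
  rw [Fin.sum_univ_eq_sum_range (fun j => tco β (((i : ℕ) - j) + (j - (i : ℕ)))) n]
  obtain ⟨i, hi⟩ := i
  obtain ⟨q, rfl⟩ := Nat.exists_eq_add_of_lt hi
  simp only
  rw [show i + q + 1 = i + (q + 1) by ring, Finset.sum_range_add, Finset.sum_range_succ']
  have e1 : ∑ j ∈ Finset.range i, tco β ((i - j) + (j - i))
      = ∑ d ∈ Finset.range i, tco β (d + 1) := by
    rw [← Finset.sum_range_reflect (fun d => tco β (d + 1))]
    refine Finset.sum_congr rfl fun j hj => ?_
    rw [Finset.mem_range] at hj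
    congr 1
    omega
  have e2 : ∑ d ∈ Finset.range q, tco β ((i - (i + (d + 1))) + ((i + (d + 1)) - i))
      = ∑ d ∈ Finset.range q, tco β (d + 1) := by
    refine Finset.sum_congr rfl fun j hj => ?_
    congr 1
    omega
  rw [e1, e2]
  have a := tco_half β h1 h2 i
  have b := tco_half β h1 h2 q
  have c : tco β 0 = 2 * w β 1 := rfl
  simp only [add_zero, Nat.sub_self]
  linarith

lemma quad (β : ℝ) (h1 : 1 < β) (h2 : β < 2) (N : ℕ) (x : Fin (N - 1) → ℝ) :
    ∑ i, ∑ j, x i * (Gmat β N i j * x j) ≤ 0 := by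
  have hsw : ∑ i, ∑ j, x i * (Gmat β N i j * x j) = ∑ i, ∑ j, x i * (Gmat β N j i * x j) := by
    rw [Finset.sum_comm]
    refine Finset.sum_congr rfl fun i _ => Finset.sum_congr rfl fun j _ => by ring
  set T : Fin (N - 1) → Fin (N - 1) → ℝ := fun i j => tco β (((i : ℕ) - j) + ((j : ℕ) - i)) with hT
  have hTs : ∀ i j, T i j = T j i := fun i j => by simp only [hT]; rw [add_comm]
  have h2' : 2 * ∑ i, ∑ j, x i * (Gmat β N i j * x j) = ∑ i, ∑ j, T i j * (x i * x j) := by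
    rw [two_mul]
    nth_rw 2 [hsw]
    rw [← Finset.sum_add_distrib]
    refine Finset.sum_congr rfl fun i _ => ?_
    rw [← Finset.sum_add_distrib]
    refine Finset.sum_congr rfl fun j _ => ?_
    simp only [hT]
    rw [← sym_entry]
    ring
  have hb : ∑ i, ∑ j, T i j * (x i * x j) ≤ ∑ i, ∑ j, T i j * ((x i ^ 2 + x j ^ 2) / 2) := by
    refine Finset.sum_le_sum fun i _ => Finset.sum_le_sum fun j _ => ?_
    by_cases hij : i = j
    · subst hij
      apply le_of_eq
      ring
    · refine mul_le_mul_of_nonneg_left (by nlinarith [sq_nonneg (x i - x j)]) ?_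
      have : (i : ℕ) ≠ j := fun h => hij (Fin.ext h)
      obtain ⟨k, hk⟩ : ∃ k, ((i : ℕ) - j) + ((j : ℕ) - i) = k + 1 :=
        ⟨((i : ℕ) - j) + ((j : ℕ) - i) - 1, by omega⟩
      simp only [hT]
      rw [hk]
      exact tco_nonneg β h1 h2 k
  have hc : ∑ i, ∑ j, T i j * ((x i ^ 2 + x j ^ 2) / 2) = ∑ i, (∑ j, T i j) * x i ^ 2 := by
    have e1 : ∑ i, ∑ j, T i j * ((x i ^ 2 + x j ^ 2) / 2)
        = ∑ i, ∑ j, T i j * (x i ^ 2 / 2) + ∑ i, ∑ j, T i j * (x j ^ 2 / 2) := by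
      simp only [← Finset.sum_add_distrib]
      refine Finset.sum_congr rfl fun i _ => Finset.sum_congr rfl fun j _ => by ring
    have e2 : ∑ i, ∑ j, T i j * (x j ^ 2 / 2) = ∑ i, ∑ j, T i j * (x i ^ 2 / 2) := by
      rw [Finset.sum_comm]
      refine Finset.sum_congr rfl fun i _ => Finset.sum_congr rfl fun j _ => by rw [hTs]
    rw [e1, e2, ← Finset.sum_add_distrib]
    refine Finset.sum_congr rfl fun i _ => ?_
    rw [← Finset.sum_mul]
    ring
  have hd : ∑ i, (∑ j, T i j) * x i ^ 2 ≤ 0 :=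
    Finset.sum_nonpos fun i _ =>
      mul_nonpos_of_nonpos_of_nonneg (row_sum β h1 h2 _ i) (sq_nonneg _)
  linarith

lemma A0_inj (N : ℕ) (β α h τ e1 e2 : ℝ) (hβ1 : 1 < β) (hβ2 : β < 2)
    (hα0 : 0 < α) (hα1 : α < 1) (hh : 0 < h) (hτ : 0 < τ)
    (he1 : 0 < e1) (he2 : 0 < e2) (x : Fin (N - 1) → ℝ)
    (hx : A0mat β α h τ e1 e2 N *ᵥ x = 0) : x = 0 := by
  have hc : 0 < h ^ β * c0 α τ := by
    refine mul_pos (Real.rpow_pos_of_pos hh _) (div_pos (mul_pos (Real.rpow_pos_of_pos hτ _)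
      (Real.rpow_pos_of_pos (by linarith) _)) (Real.Gamma_pos_of_pos (by linarith)))
  have hq := quad β hβ1 hβ2 N x
  have hG : x ⬝ᵥ (Gmat β N *ᵥ x) ≤ 0 := by
    simpa [dotProduct, Matrix.mulVec, Finset.mul_sum] using hq
  have hGT : x ⬝ᵥ ((Gmat β N)ᵀ *ᵥ x) = x ⬝ᵥ (Gmat β N *ᵥ x) := by
    rw [Matrix.mulVec_transpose, dotProduct_comm, ← Matrix.dotProduct_mulVec]
  have h0 : x ⬝ᵥ (A0mat β α h τ e1 e2 N *ᵥ x) = 0 := by rw [hx, dotProduct_zero]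
  simp only [A0mat, Kmat, Matrix.sub_mulVec, Matrix.add_mulVec, Matrix.smul_mulVec,
    Matrix.one_mulVec, dotProduct_sub, dotProduct_add, dotProduct_smul, smul_eq_mul, hGT] at h0
  have hs : 0 ≤ x ⬝ᵥ x := Finset.sum_nonneg fun i _ => mul_self_nonneg _
  have hn : (1 - α / 2) * (e1 * x ⬝ᵥ (Gmat β N *ᵥ x) + e2 * x ⬝ᵥ (Gmat β N *ᵥ x)) ≤ 0 :=
    mul_nonpos_of_nonneg_of_nonpos (by linarith) (by nlinarith)
  have : x ⬝ᵥ x = 0 := by nlinarith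
  exact dotProduct_self_eq_zero.mp this

theorem W_invertible (N M : ℕ) (hN : 3 ≤ N) (hM : 3 ≤ M)
    (β α h τ e1 e2 : ℝ) (hβ1 : 1 < β) (hβ2 : β < 2)
    (hα0 : 0 < α) (hα1 : α < 1) (hh : 0 < h) (hτ : 0 < τ)
    (he1 : 0 < e1) (he2 : 0 < e2) :
    IsUnit (Wmat β α h τ e1 e2 M N) := by
  rw [← Matrix.mulVec_injective_iff_isUnit]
  refine (injective_iff_map_eq_zero (Matrix.mulVecLin (Wmat β α h τ e1 e2 M N))).mpr ?_
  intro v hv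
  rw [Matrix.mulVecLin_apply] at hv
  have main : ∀ m : ℕ, ∀ i : Fin (M - 1), (i : ℕ) = m → ∀ a, v (i, a) = 0 := by
    intro m
    induction m using Nat.strong_induction_on with
    | _ m ih =>
      intro i hi
      have hz : (fun a => v (i, a)) = 0 := by
        refine A0_inj N β α h τ e1 e2 hβ1 hβ2 hα0 hα1 hh hτ he1 he2 _ ?_
        funext a
        have hva := congrFun hv (i, a)
        simp only [Matrix.mulVec, dotProduct, Fintype.sum_prod_type] at hva ⊢
        rw [Finset.sum_eq_single i] at hva
        · simpa [Wmat, Ablk] using hva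
        · intro k _ hk
          refine Finset.sum_eq_zero fun b _ => ?_
          by_cases hle : (k : ℕ) ≤ i
          · have hne : (k : ℕ) ≠ i := fun h => hk (Fin.ext h)
            rw [ih k (by omega) k rfl b, mul_zero]
          · simp only [Wmat, Matrix.of_apply, if_neg hle, zero_mul]
        · simp
      exact fun a => congrFun hz a
  funext p
  exact main _ p.1 rfl p.2
end

section
/- (Lemma 3.2) Suppose 0 < v̂ < h^β·c_0^{(α,σ)}. Then for every integer N ≥ 3, the operator norm of the inverse of P_sk satisfies ‖P_sk^{−1}‖_2 ≤ 1/v̂. -/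
open scoped Matrix

/-- The skew-circulant matrix `sk(G_β)` with first column
`(ω_1, ω_2, …, ω_{N−2}, −ω_0)ᵀ`. -/
noncomputable def skG (β : ℝ) (N : ℕ) : Matrix (Fin (N - 1)) (Fin (N - 1)) ℝ :=
  Matrix.of fun i j =>
    if (j : ℕ) ≤ (i : ℕ) then
      (if (i : ℕ) - (j : ℕ) = N - 2 then -(w β 0) else w β ((i : ℕ) - (j : ℕ) + 1))
    else
      -(if N - 1 - ((j : ℕ) - (i : ℕ)) = N - 2 then -(w β 0)
        else w β (N - 1 - ((j : ℕ) - (i : ℕ)) + 1))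

/-- `sk(K_N) = e₁·sk(G_β) + e₂·sk(G_β)ᵀ`. -/
noncomputable def skK (β e1 e2 : ℝ) (N : ℕ) : Matrix (Fin (N - 1)) (Fin (N - 1)) ℝ :=
  e1 • skG β N + e2 • (skG β N)ᵀ

/-- The skew-circulant preconditioner `P_sk = h^β·c_0^{(α,σ)}·I − σ·sk(K_N)`. -/
noncomputable def Psk (β α h τ e1 e2 : ℝ) (N : ℕ) :
    Matrix (Fin (N - 1)) (Fin (N - 1)) ℝ :=
  (h ^ β * c0 α τ) • (1 : Matrix (Fin (N - 1)) (Fin (N - 1)) ℝ) -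
    (1 - α / 2) • skK β e1 e2 N
/-- The matrix operator norm induced by the Euclidean vector norm. -/
noncomputable def l2OpNorm {n : ℕ} (M : Matrix (Fin n) (Fin n) ℝ) : ℝ :=
  ‖Matrix.toEuclideanCLM (𝕜 := ℝ) M‖

theorem gcoef_sum (β : ℝ) (m : ℕ) :
    β * ∑ k ∈ Finset.range (m + 1), gcoef β k = (β - m) * gcoef β m := by
  induction m with
  | zero => simp [gcoef]
  | succ m ih =>
    rw [Finset.sum_range_succ, mul_add, ih]
    simp only [gcoef]
    have : ((m : ℝ) + 1) ≠ 0 := by positivity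
    push_cast
    field_simp
    ring

theorem gcoef_pos (β : ℝ) (h1 : 1 < β) (h2 : β < 2) (m : ℕ) : 0 < gcoef β (m + 2) := by
  induction m with
  | zero =>
    simp only [gcoef]
    norm_num
    nlinarith
  | succ m ih =>
    have e : gcoef β (m + 1 + 2) = (1 - (β + 1) / (((m + 2 : ℕ) : ℝ) + 1)) * gcoef β (m + 2) := rfl
    rw [e]
    refine mul_pos ?_ ih
    have hm : (0 : ℝ) ≤ m := Nat.cast_nonneg m
    push_cast
    rw [sub_pos, div_lt_one (by linarith)]
    linarith

theorem gsum_nonpos (β : ℝ) (h1 : 1 < β) (h2 : β < 2) (m : ℕ) :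
    ∑ k ∈ Finset.range (m + 2), gcoef β k ≤ 0 := by
  have h := gcoef_sum β (m + 1)
  have : (β - (m + 1 : ℕ)) * gcoef β (m + 1) ≤ 0 := by
    rcases m with _ | m
    · simp only [gcoef]; norm_num; nlinarith
    · have := gcoef_pos β h1 h2 m
      have hm : (0 : ℝ) ≤ m := Nat.cast_nonneg m
      push_cast
      nlinarith
  by_contra hc
  push Not at hc
  have : 0 < β * ∑ k ∈ Finset.range (m + 2), gcoef β k := by positivity
  linarith

theorem wsum_eq (β : ℝ) (m : ℕ) :
    ∑ k ∈ Finset.range (m + 1), w β k = β / 2 * ∑ k ∈ Finset.range (m + 1), gcoef β k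
      + (2 - β) / 2 * ∑ k ∈ Finset.range m, gcoef β k := by
  induction m with
  | zero => simp [w]
  | succ m ih =>
    rw [Finset.sum_range_succ, ih, Finset.sum_range_succ _ (m + 1), Finset.sum_range_succ _ m]
    simp only [w]
    ring

theorem wsum_nonpos (β : ℝ) (h1 : 1 < β) (h2 : β < 2) (m : ℕ) :
    ∑ k ∈ Finset.range (m + 3), w β k ≤ 0 := by
  rw [wsum_eq β (m + 2)]
  have a := gsum_nonpos β h1 h2 m
  have b := gsum_nonpos β h1 h2 (m + 1)
  have e : m + 2 + 1 = m + 1 + 2 := rfl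
  rw [e]
  nlinarith

theorem w_nonneg (β : ℝ) (h1 : 1 < β) (h2 : β < 2) (m : ℕ) : 0 ≤ w β (m + 3) := by
  have a := gcoef_pos β h1 h2 m
  have b := gcoef_pos β h1 h2 (m + 1)
  have e : w β (m + 3) = β / 2 * gcoef β (m + 1 + 2) + (2 - β) / 2 * gcoef β (m + 2) := rfl
  rw [e]
  nlinarith

theorem w02_nonneg (β : ℝ) (h1 : 1 < β) : 0 ≤ w β 0 + w β 2 := by
  simp only [w, gcoef]
  norm_num
  have : 0 ≤ β * (β - 1) * (β + 2) := by
    have : 0 ≤ β - 1 := by linarith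
    positivity
  nlinarith

theorem w1_nonpos (β : ℝ) (h1 : 1 < β) : w β 1 ≤ 0 := by
  simp only [w, gcoef]
  norm_num
  nlinarith

/-- Dominating coefficients for the size `t + 2`. -/
noncomputable def bco (β : ℝ) (t m : ℕ) : ℝ :=
  if m = 0 then w β 1 else if m = t + 1 then 0 else if m = 1 then w β 0 + w β 2 else w β (m + 1)

theorem bco_nonneg (β : ℝ) (h1 : 1 < β) (h2 : β < 2) (t m : ℕ) (hm : m ≠ 0) :
    0 ≤ bco β t m := by
  unfold bco
  rw [if_neg hm]
  split_ifs with a b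
  · exact le_rfl
  · exact w02_nonneg β h1
  · obtain ⟨k, rfl⟩ : ∃ k, m = k + 2 := ⟨m - 2, by omega⟩
    exact w_nonneg β h1 h2 k

theorem bco_sum (β : ℝ) (h1 : 1 < β) (h2 : β < 2) (t : ℕ) :
    ∑ k : Fin (t + 2), bco β t k ≤ 0 := by
  rw [Fin.sum_univ_eq_sum_range (fun k => bco β t k)]
  rcases t with _ | s
  · simp [Finset.sum_range_succ, bco, w1_nonpos β h1]
  · have h := wsum_nonpos β h1 h2 s
    rw [Finset.sum_range_succ, Finset.sum_range_succ', Finset.sum_range_succ']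
    rw [Finset.sum_range_succ', Finset.sum_range_succ', Finset.sum_range_succ'] at h
    have e : ∑ k ∈ Finset.range s, bco β (s + 1) (k + 1 + 1)
        = ∑ k ∈ Finset.range s, w β (k + 1 + 1 + 1) := by
      refine Finset.sum_congr rfl fun k hk => ?_
      rw [Finset.mem_range] at hk
      unfold bco
      rw [if_neg (by omega), if_neg (by omega), if_neg (by omega)]
    rw [e]
    have e0 : bco β (s + 1) 0 = w β 1 := by simp [bco]
    have e1 : bco β (s + 1) (0 + 1) = w β 0 + w β 2 := by simp [bco]
    have e2 : bco β (s + 1) (s + 1 + 1) = 0 := by simp [bco]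
    rw [e0, e1, e2]
    simp only [zero_add, Nat.reduceAdd] at h ⊢
    linarith

theorem entry_abs (β : ℝ) (h1 : 1 < β) (h2 : β < 2) (t d : ℕ) (hd : 0 < d) (hd2 : d < t + 2) :
    |(if d = t + 1 then -(w β 0) else w β (d + 1))
      + -(if t + 2 - d = t + 1 then -(w β 0) else w β (t + 2 - d + 1))|
      ≤ bco β t d + bco β t (t + 2 - d) := by
  have n1 := bco_nonneg β h1 h2 t d (by omega)
  have n2 := bco_nonneg β h1 h2 t (t + 2 - d) (by omega)
  by_cases a : d = t + 1
  · subst a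
    have e : t + 2 - (t + 1) = 1 := by omega
    rw [e] at *
    by_cases b : t = 0
    · subst b; simpa using add_nonneg n1 n2
    · have e3 : bco β t (t + 1) = 0 := by simp [bco]
      have e4 : bco β t 1 = w β 0 + w β 2 := by simp [bco, b]
      have := w02_nonneg β h1
      rw [e3, e4, if_pos rfl, if_neg (by omega), abs_le]
      constructor <;> norm_num <;> linarith
  · by_cases c : d = 1
    · subst c
      have e : t + 2 - 1 = t + 1 := by omega
      rw [e] at *
      have e3 : bco β t (t + 1) = 0 := by simp [bco]
      have e4 : bco β t 1 = w β 0 + w β 2 := by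
        unfold bco
        rw [if_neg (by omega), if_neg (by omega), if_pos rfl]
      have := w02_nonneg β h1
      rw [e3, e4, if_neg a, if_pos rfl, abs_le]
      constructor <;> norm_num <;> linarith
    · have e3 : bco β t d = w β (d + 1) := by
        unfold bco
        rw [if_neg (by omega), if_neg (by omega), if_neg (by omega)]
      have e4 : bco β t (t + 2 - d) = w β (t + 2 - d + 1) := by
        unfold bco
        rw [if_neg (by omega), if_neg (by omega), if_neg (by omega)]
      rw [e3] at n1
      rw [e4] at n2
      rw [e3, e4]
      rw [if_neg a, if_neg (by omega), abs_le]
      constructor <;> linarith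

theorem abs_quad {s b x y : ℝ} (h : |s| ≤ b) : x * s * y ≤ b * ((x ^ 2 + y ^ 2) / 2) := by
  rw [abs_le] at h
  nlinarith [mul_nonneg (sub_nonneg.2 h.2) (sq_nonneg (x + y)),
    mul_nonneg (by linarith [h.1] : 0 ≤ b + s) (sq_nonneg (x - y))]

theorem entry_bound_lt (β : ℝ) (h1 : 1 < β) (h2 : β < 2) (t : ℕ) (i j : Fin (t + 2)) (hij : j < i) :
    |skG β (t + 3) i j + skG β (t + 3) j i|
      ≤ bco β t ((i - j : Fin (t + 2)) : ℕ) + bco β t ((j - i : Fin (t + 2)) : ℕ) := by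
  have hv : (j : ℕ) < (i : ℕ) := hij
  have a1 : ((i - j : Fin (t + 2)) : ℕ) = (i : ℕ) - j := Fin.sub_val_of_le hij.le
  have a2 : ((j - i : Fin (t + 2)) : ℕ) = t + 2 - ((i : ℕ) - j) := by
    rw [Fin.coe_sub_iff_lt.2 hij]; omega
  rw [a1, a2]
  have hi := i.isLt
  have := entry_abs β h1 h2 t ((i : ℕ) - j) (by omega) (by omega)
  have e1 : skG β (t + 3) i j = (if (i : ℕ) - j = t + 1 then -(w β 0) else w β ((i : ℕ) - j + 1)) := by
    change (if (j : ℕ) ≤ (i : ℕ) then _ else _) = _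
    rw [if_pos hv.le]; rfl
  have e2 : skG β (t + 3) j i = -(if t + 2 - ((i : ℕ) - j) = t + 1 then -(w β 0)
      else w β (t + 2 - ((i : ℕ) - j) + 1)) := by
    change (if (i : ℕ) ≤ (j : ℕ) then _ else _) = _
    rw [if_neg (by omega)]; rfl
  rw [e1, e2]
  exact this

theorem entry_quad (β : ℝ) (h1 : 1 < β) (h2 : β < 2) (t : ℕ) (i j : Fin (t + 2))
    (x : Fin (t + 2) → ℝ) :
    x i * (skG β (t + 3) i j + skG β (t + 3) j i) * x j
      ≤ (bco β t ((i - j : Fin (t + 2)) : ℕ) + bco β t ((j - i : Fin (t + 2)) : ℕ))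
        * ((x i ^ 2 + x j ^ 2) / 2) := by
  rcases lt_trichotomy i j with h | h | h
  · apply abs_quad
    have := entry_bound_lt β h1 h2 t j i h
    rw [add_comm (skG _ _ _ _), add_comm (bco _ _ _)]
    exact this
  · subst h
    have e : skG β (t + 3) i i = w β 1 := by simp [skG]
    rw [e]
    simp only [sub_self, Fin.val_zero, bco, if_true]
    exact le_of_eq (by ring)
  · exact abs_quad (entry_bound_lt β h1 h2 t i j h)

theorem sum_b (β : ℝ) (t : ℕ) (x : Fin (t + 2) → ℝ) :
    ∑ i : Fin (t + 2), ∑ j : Fin (t + 2), bco β t ((i - j : Fin (t + 2)) : ℕ) * x i ^ 2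
      = (∑ k : Fin (t + 2), bco β t k) * ∑ i, x i ^ 2 := by
  rw [Finset.mul_sum]
  refine Finset.sum_congr rfl fun i _ => ?_
  rw [← Finset.sum_mul]
  congr 1
  exact (Equiv.subLeft i).sum_comp (fun k : Fin (t + 2) => bco β t k)

theorem sum_b' (β : ℝ) (t : ℕ) (x : Fin (t + 2) → ℝ) :
    ∑ i : Fin (t + 2), ∑ j : Fin (t + 2), bco β t ((j - i : Fin (t + 2)) : ℕ) * x i ^ 2
      = (∑ k : Fin (t + 2), bco β t k) * ∑ i, x i ^ 2 := by
  rw [Finset.mul_sum]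
  refine Finset.sum_congr rfl fun i _ => ?_
  rw [← Finset.sum_mul]
  congr 1
  exact (Equiv.subRight i).sum_comp (fun k : Fin (t + 2) => bco β t k)

theorem skG_quad (β : ℝ) (h1 : 1 < β) (h2 : β < 2) (t : ℕ) (x : Fin (t + 2) → ℝ) :
    ∑ i : Fin (t + 2), ∑ j : Fin (t + 2), x i * skG β (t + 3) i j * x j ≤ 0 := by
  have key := Finset.sum_le_sum fun i (_ : i ∈ (Finset.univ : Finset (Fin (t + 2)))) =>
    Finset.sum_le_sum fun j (_ : j ∈ (Finset.univ : Finset (Fin (t + 2)))) =>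
      entry_quad β h1 h2 t i j x
  have L : ∑ i : Fin (t + 2), ∑ j : Fin (t + 2),
      x i * (skG β (t + 3) i j + skG β (t + 3) j i) * x j
      = 2 * ∑ i : Fin (t + 2), ∑ j : Fin (t + 2), x i * skG β (t + 3) i j * x j := by
    have sw : ∑ i : Fin (t + 2), ∑ j : Fin (t + 2), x i * skG β (t + 3) j i * x j
        = ∑ i : Fin (t + 2), ∑ j : Fin (t + 2), x i * skG β (t + 3) i j * x j := by
      rw [Finset.sum_comm]
      refine Finset.sum_congr rfl fun i _ => Finset.sum_congr rfl fun j _ => by ring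
    rw [two_mul]
    nth_rewrite 2 [← sw]
    simp only [← Finset.sum_add_distrib]
    refine Finset.sum_congr rfl fun i _ => Finset.sum_congr rfl fun j _ => by ring
  have R : ∑ i : Fin (t + 2), ∑ j : Fin (t + 2),
      (bco β t ((i - j : Fin (t + 2)) : ℕ) + bco β t ((j - i : Fin (t + 2)) : ℕ))
        * ((x i ^ 2 + x j ^ 2) / 2)
      = 2 * ((∑ k : Fin (t + 2), bco β t k) * ∑ i, x i ^ 2) := by
    have s1 := sum_b β t x
    have s2 := sum_b' β t x
    have s3 := s1
    have s4 := s2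
    rw [Finset.sum_comm] at s3 s4
    calc _ = (1 / 2) * ((∑ i : Fin (t + 2), ∑ j : Fin (t + 2),
            bco β t ((i - j : Fin (t + 2)) : ℕ) * x i ^ 2)
          + (∑ i : Fin (t + 2), ∑ j : Fin (t + 2), bco β t ((j - i : Fin (t + 2)) : ℕ) * x i ^ 2)
          + (∑ i : Fin (t + 2), ∑ j : Fin (t + 2), bco β t ((j - i : Fin (t + 2)) : ℕ) * x j ^ 2)
          + (∑ i : Fin (t + 2), ∑ j : Fin (t + 2),
            bco β t ((i - j : Fin (t + 2)) : ℕ) * x j ^ 2)) := by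
          simp only [← Finset.sum_add_distrib, Finset.mul_sum]
          refine Finset.sum_congr rfl fun i _ => Finset.sum_congr rfl fun j _ => by ring
      _ = _ := by rw [s1, s2, s3, s4]; ring
  rw [L, R] at key
  have hb := bco_sum β h1 h2 t
  have hx : 0 ≤ ∑ i, x i ^ 2 := Finset.sum_nonneg fun i _ => sq_nonneg (x i)
  nlinarith [mul_nonneg (neg_nonneg.2 hb) hx]

/-- A coercive real matrix has a bounded inverse. -/
theorem inv_norm_of_coercive {n : ℕ} (M : Matrix (Fin n) (Fin n) ℝ) (c : ℝ) (hc : 0 < c)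
    (hM : ∀ x : Fin n → ℝ, c * (x ⬝ᵥ x) ≤ x ⬝ᵥ (M *ᵥ x)) :
    l2OpNorm M⁻¹ ≤ 1 / c := by
  have hU : IsUnit M := by
    rw [← Matrix.mulVec_injective_iff_isUnit]
    refine (injective_iff_map_eq_zero (Matrix.mulVecLin M)).2 ?_
    intro x hx
    have h := hM x
    have hx' : M *ᵥ x = 0 := hx
    rw [hx', dotProduct_zero] at h
    have h0 : 0 ≤ x ⬝ᵥ x := Finset.sum_nonneg fun i _ => mul_self_nonneg (x i)
    exact dotProduct_self_eq_zero.1 (le_antisymm (by nlinarith) h0)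
  have hdet : IsUnit M.det := (Matrix.isUnit_iff_isUnit_det M).1 hU
  unfold l2OpNorm
  refine ContinuousLinearMap.opNorm_le_bound _ (by positivity) fun y => ?_
  set x := Matrix.toEuclideanCLM (𝕜 := ℝ) M⁻¹ y with hxdef
  have hx : x.ofLp = M⁻¹ *ᵥ y.ofLp := by
    rw [hxdef, Matrix.ofLp_toEuclideanCLM]
  have hy : M *ᵥ x.ofLp = y.ofLp := by
    rw [hx, Matrix.mulVec_mulVec, Matrix.mul_nonsing_inv _ hdet, Matrix.one_mulVec]
  have h := hM x.ofLp
  rw [hy] at h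
  have e1 : x.ofLp ⬝ᵥ x.ofLp = ‖x‖ ^ 2 := by
    rw [EuclideanSpace.real_norm_sq_eq]
    exact Finset.sum_congr rfl fun i _ => (sq _).symm
  have e2 : x.ofLp ⬝ᵥ y.ofLp = inner ℝ x y := by
    rw [PiLp.inner_apply]
    exact Finset.sum_congr rfl fun i _ => mul_comm _ _
  rw [e1, e2] at h
  have h3 := real_inner_le_norm x y
  rcases (norm_nonneg x).eq_or_lt with h0 | h0
  · rw [← h0]; positivity
  · rw [one_div, ← div_eq_inv_mul, le_div_iff₀ hc]
    nlinarith

theorem Psk_inv_norm_bound (N : ℕ) (hN : 3 ≤ N)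
    (β α h τ e1 e2 v : ℝ) (hβ1 : 1 < β) (hβ2 : β < 2)
    (hα0 : 0 < α) (hα1 : α < 1) (hh : 0 < h) (hτ : 0 < τ)
    (he1 : 0 < e1) (he2 : 0 < e2)
    (hv0 : 0 < v) (hv : v < h ^ β * c0 α τ) :
    l2OpNorm ((Psk β α h τ e1 e2 N)⁻¹) ≤ 1 / v := by
  obtain ⟨t, rfl⟩ : ∃ t, N = t + 3 := ⟨N - 3, by omega⟩
  have hc : 0 < h ^ β * c0 α τ := hv0.trans hv
  refine (inv_norm_of_coercive _ (h ^ β * c0 α τ) hc fun x => ?_).trans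
    (one_div_le_one_div_of_le hv0 hv.le)
  have q : x ⬝ᵥ (skG β (t + 3) *ᵥ x) ≤ 0 := by
    have := skG_quad β hβ1 hβ2 t x
    refine le_trans (le_of_eq ?_) this
    unfold dotProduct Matrix.mulVec dotProduct
    simp only [Finset.mul_sum, mul_assoc]
    rfl
  have q2 : x ⬝ᵥ ((skG β (t + 3))ᵀ *ᵥ x) = x ⬝ᵥ (skG β (t + 3) *ᵥ x) := by
    rw [Matrix.mulVec_transpose, dotProduct_comm, Matrix.dotProduct_mulVec]
  unfold Psk skK
  simp only [Matrix.sub_mulVec, Matrix.add_mulVec, Matrix.smul_mulVec, Matrix.one_mulVec,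
    dotProduct_sub, dotProduct_add, dotProduct_smul, smul_eq_mul, q2]
  have hs : 0 < (1 - α / 2) * (e1 + e2) := mul_pos (by linarith) (by linarith)
  nlinarith [mul_nonneg hs.le (neg_nonneg.2 q)]
end
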